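/- Let A be a nonempty compact set in ℝⁿ. Then d(A) ≤ rad(A), where rad(A) := inf_{x ∈ ℝⁿ} sup_{a ∈ A} |x − a| is the radius of the smallest ball containing A. -/

import Mathlib

/-- Hausdorff distance from a set to its convex hull. -/
noncomputable def hdist {n : ℕ} (A : Set (EuclideanSpace ℝ (Fin n))) : ℝ :=
  Metric.hausdorffDist (convexHull ℝ A) A

/-- The radius of the smallest ball containing `A`. -/
noncomputable def rad {n : ℕ} (A : Set (EuclideanSpace ℝ (Fin n))) : ℝ :=
  ⨅ x : EuclideanSpace ℝ (Fin n), ⨆ a ∈ A, dist x a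

theorem exists_inner_nonneg_of_mem_convexHull {E : Type*} [NormedAddCommGroup E]
    [InnerProductSpace ℝ E] {A : Set E} {p : E} (hp : p ∈ convexHull ℝ A) (v : E) :
    ∃ a ∈ A, 0 ≤ inner ℝ v (a - p) := by
  by_contra! h
  have hsub : A ⊆ {a | innerSL ℝ v a < inner ℝ v p} := fun a ha => by
    have := h a ha
    rw [inner_sub_right] at this
    simpa using sub_neg.mp this
  have hconv : Convex ℝ {a | innerSL ℝ v a < inner ℝ v p} :=
    convex_halfSpace_lt (innerSL ℝ v).toLinearMap.isLinear _
  simpa using convexHull_min hsub hconv hp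

theorem exists_dist_le_dist_of_mem_convexHull {E : Type*} [NormedAddCommGroup E]
    [InnerProductSpace ℝ E] {A : Set E} {p : E} (hp : p ∈ convexHull ℝ A) (x : E) :
    ∃ a ∈ A, dist p a ≤ dist x a := by
  obtain ⟨a, ha, h⟩ := exists_inner_nonneg_of_mem_convexHull hp (p - x)
  refine ⟨a, ha, ?_⟩
  rw [dist_comm p, dist_comm x, dist_eq_norm, dist_eq_norm]
  refine le_of_sq_le_sq ?_ (norm_nonneg _)
  have key := norm_add_sq_real (p - x) (a - p)
  rw [sub_add_sub_cancel'] at key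
  nlinarith [sq_nonneg ‖p - x‖]

theorem dist_le_biSup_dist {E : Type*} [PseudoMetricSpace E] {A : Set E}
    (hA : Bornology.IsBounded A) (x : E) {a : E} (ha : a ∈ A) :
    dist x a ≤ ⨆ b ∈ A, dist x b := by
  obtain ⟨r, hr⟩ := hA.subset_closedBall x
  have hbdd : BddAbove (Set.range fun b => ⨆ _ : b ∈ A, dist x b) := by
    refine ⟨max r 0, ?_⟩
    rintro _ ⟨b, rfl⟩
    refine Real.iSup_le (fun hb => ?_) (le_max_right _ _)
    exact le_max_of_le_left (by simpa [dist_comm] using hr hb)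
  refine le_trans ?_ (le_ciSup hbdd a)
  simp [ha]

theorem hdist_le_rad {n : ℕ} (A : Set (EuclideanSpace ℝ (Fin n)))
    (hA : A.Nonempty) (hAc : IsCompact A) :
    hdist A ≤ rad A := by
  refine le_ciInf fun x => ?_
  have hle : ∀ a ∈ A, dist x a ≤ ⨆ b ∈ A, dist x b :=
    fun a ha => dist_le_biSup_dist hAc.isBounded x ha
  obtain ⟨a₀, ha₀⟩ := hA
  have h0 := dist_nonneg.trans (hle a₀ ha₀)
  refine Metric.hausdorffDist_le_of_mem_dist h0 (fun p hp => ?_) fun a ha =>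
    ⟨a, subset_convexHull ℝ A ha, by simpa using h0⟩
  obtain ⟨a, ha, h⟩ := exists_dist_le_dist_of_mem_convexHull hp x
  exact ⟨a, ha, h.trans (hle a ha)⟩
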